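/- arXiv:1703.03092 — 2 statements merged into one kernel-verified Lean document; each statement's English description precedes it below -/
import Mathlib

section
/- Every odd positive integer n can be written as n = a² + b² + c² + d² with integers a, b, c, d satisfying a + b + c + d = 1. -/
open MeasureTheory in
theorem exists_int_ne_zero_sum_sq_mulVec_lt (A : Matrix (Fin 3) (Fin 3) ℝ) (hA : A.det ≠ 0)
    {r : ℝ} (hr : 0 < r) (h : 8 * |A.det| < r ^ 3 * (Real.pi * 4 / 3)) :
    ∃ x : Fin 3 → ℤ, x ≠ 0 ∧ ∑ i, (A.mulVec (fun j => (x j : ℝ))) i ^ 2 < r ^ 2 := by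
  set f : (Fin 3 → ℝ) →ₗ[ℝ] EuclideanSpace ℝ (Fin 3) :=
    (WithLp.linearEquiv 2 ℝ (Fin 3 → ℝ)).symm.toLinearMap ∘ₗ Matrix.toLin' A with hf
  have hvol : volume (f ⁻¹' Metric.ball 0 r) =
      ENNReal.ofReal |A.det⁻¹| * ENNReal.ofReal (r ^ 3 * (Real.pi * 4 / 3)) := by
    have h1 : f ⁻¹' Metric.ball 0 r =
        Matrix.toLin' A ⁻¹' (WithLp.toLp 2 ⁻¹' Metric.ball (0 : EuclideanSpace ℝ (Fin 3)) r) := rfl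
    rw [h1, Measure.addHaar_preimage_linearMap _ (by simpa using hA),
      (PiLp.volume_preserving_toLp (Fin 3)).measure_preimage
        measurableSet_ball.nullMeasurableSet, EuclideanSpace.volume_ball_fin_three,
      LinearMap.det_toLin', ENNReal.ofReal_mul (by positivity), ENNReal.ofReal_pow hr.le]
  have hlt : volume (ZSpan.fundamentalDomain (Pi.basisFun ℝ (Fin 3))) *
      2 ^ Module.finrank ℝ (Fin 3 → ℝ) < volume (f ⁻¹' Metric.ball 0 r) := by
    have h8 : (1 * 2 ^ 3 : ENNReal) = ENNReal.ofReal 8 := by norm_num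
    rw [hvol, ZSpan.fundamentalDomain_pi_basisFun, volume_pi, Measure.pi_pi,
      ← ENNReal.ofReal_mul (abs_nonneg _)]
    simp only [Real.volume_Ico, sub_zero, ENNReal.ofReal_one, Finset.prod_const_one,
      Module.finrank_fin_fun, h8]
    rw [ENNReal.ofReal_lt_ofReal_iff_of_nonneg (by norm_num), abs_inv,
      ← div_eq_inv_mul, lt_div_iff₀ (abs_pos.mpr hA)]
    exact h
  have : Countable (Submodule.span ℤ (Set.range (Pi.basisFun ℝ (Fin 3)))).toAddSubgroup :=
    inferInstanceAs (Countable (Submodule.span ℤ (Set.range (Pi.basisFun ℝ (Fin 3)))))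
  obtain ⟨⟨y, hy⟩, hy0, hys⟩ := exists_ne_zero_mem_lattice_of_measure_mul_two_pow_lt_measure
    (ZSpan.isAddFundamentalDomain' (Pi.basisFun ℝ (Fin 3)) volume)
    (fun x hx => by simpa using hx) ((convex_ball 0 r).linear_preimage f) hlt
  obtain ⟨x, rfl⟩ : ∃ x : Fin 3 → ℤ, (fun j => (x j : ℝ)) = y := by
    have := ((Pi.basisFun ℝ (Fin 3)).mem_span_iff_repr_mem ℤ y).mp hy
    choose x hx using this
    exact ⟨x, funext fun j => by simpa using hx j⟩
  refine ⟨x, ?_, ?_⟩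
  · rintro rfl
    exact hy0 (by ext; simp)
  · have := mem_ball_zero_iff.mp hys
    rw [EuclideanSpace.norm_eq, Real.sqrt_lt' hr] at this
    simpa [hf] using this

theorem exists_int_ne_zero_ankeny_form_lt {m q : ℝ} (hm : 0 < m) (hq : 0 < q) (b : ℝ) :
    ∃ x y z : ℤ, ¬ (x = 0 ∧ y = 0 ∧ z = 0) ∧
      2 * q * (2 * q * x + b * y + m * z) ^ 2 + (2 * q * x + b * y) ^ 2 + m * y ^ 2
        < 2 * q * (2 * m) := by
  set s := Real.sqrt (2 * q)
  set t := Real.sqrt m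
  have hs : 0 < s := Real.sqrt_pos.mpr (by positivity)
  have ht : 0 < t := Real.sqrt_pos.mpr hm
  have hs2 : s ^ 2 = 2 * q := Real.sq_sqrt (by positivity)
  have ht2 : t ^ 2 = m := Real.sq_sqrt hm.le
  have hdet : (!![2 * q, b, m; s, b / s, 0; 0, t / s, 0] : Matrix (Fin 3) (Fin 3) ℝ).det =
      t ^ 3 := by
    simp [Matrix.det_fin_three]
    field_simp
    rw [← ht2]
  obtain ⟨x, hx0, hx⟩ := exists_int_ne_zero_sum_sq_mulVec_lt
    !![2 * q, b, m; s, b / s, 0; 0, t / s, 0] (hdet ▸ by positivity)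
    (r := Real.sqrt 2 * t) (by positivity) (by
      rw [hdet, abs_of_pos (by positivity), mul_pow]
      have h2 : Real.sqrt 2 ^ 3 = 2 * Real.sqrt 2 := by
        rw [pow_succ, Real.sq_sqrt (by norm_num)]
      have h3 : (1.4 : ℝ) < Real.sqrt 2 := Real.lt_sqrt_of_sq_lt (by norm_num)
      have := Real.pi_gt_three
      rw [h2]
      have : 8 < 2 * Real.sqrt 2 * (Real.pi * 4 / 3) := by nlinarith
      nlinarith [pow_pos ht 3])
  refine ⟨x 0, x 1, x 2, ?_, ?_⟩
  · rintro ⟨h0, h1, h2⟩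
    exact hx0 (funext fun i => by fin_cases i <;> assumption)
  · rw [mul_pow, Real.sq_sqrt (by norm_num), ht2] at hx
    have := mul_lt_mul_of_pos_left hx (by positivity : 0 < 2 * q)
    refine lt_of_eq_of_lt ?_ this
    simp [Matrix.mulVec, dotProduct, Fin.sum_univ_three]
    field_simp
    rw [← hs2, ← ht2]
    field_simp

theorem Int.sq_mod_eight_eq_one_of_odd {x : ℤ} (hx : Odd x) : x ^ 2 % 8 = 1 := by
  have := Int.eight_dvd_sq_sub_one_of_odd hx
  lia

theorem Int.dvd_and_dvd_of_prime_dvd_sq_add_sq {p : ℕ} [Fact p.Prime] (hp : p % 4 = 3) {a b : ℤ}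
    (h : (p : ℤ) ∣ a ^ 2 + b ^ 2) : (p : ℤ) ∣ a ∧ (p : ℤ) ∣ b := by
  have hJ : jacobiSym (-1) p = -1 := by
    rw [jacobiSym.at_neg_one (Nat.odd_iff.mpr (by lia)), ZMod.χ₄_nat_three_mod_four hp]
  exact jacobiSym.prime_dvd_of_eq_neg_one hJ (by convert h using 1; ring)

theorem two_mul_eq_sq_add_sq_of_ankeny {m q : ℕ} (hm : Squarefree m) (hq : q.Prime)
    (hq4 : q % 4 = 1) (hmq : (m : ℤ) ∣ 2 * q + 1) {e R y : ℤ} {v : ℕ} (hv : 0 < v)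
    (hR : R ^ 2 + 2 * v = m) (he : 4 * q * v = e ^ 2 + m * y ^ 2) :
    ∃ S T : ℕ, 2 * v = S ^ 2 + T ^ 2 := by
  rw [Nat.eq_sq_add_sq_iff]
  intro p hp hp4
  have hpp := Nat.prime_of_mem_primeFactors hp
  have : Fact p.Prime := ⟨hpp⟩
  have hpZ : Prime (p : ℤ) := Nat.prime_iff_prime_int.mp hpp
  have hpv : (p : ℤ) ∣ 2 * v := mod_cast Nat.dvd_of_mem_primeFactors hp
  have hkey : 2 * v * (2 * q - y ^ 2) = e ^ 2 + (R * y) ^ 2 := by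
    linear_combination he - y ^ 2 * hR
  by_cases hpm : (p : ℤ) ∣ m
  · have hpR : (p : ℤ) ∣ R := by
      refine hpZ.dvd_of_dvd_pow (n := 2) ?_
      rw [eq_sub_of_add_eq hR]
      exact hpm.sub hpv
    have hpe : (p : ℤ) ∣ e :=
      (Int.dvd_and_dvd_of_prime_dvd_sq_add_sq hp4 (hkey ▸ hpv.mul_right _)).1
    obtain ⟨k, hk⟩ := hpm
    obtain ⟨R', rfl⟩ := hpR
    obtain ⟨e', rfl⟩ := hpe
    have hpk : ¬ (p : ℤ) ∣ k := by
      rintro ⟨l, rfl⟩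
      have : p * p ∣ m := by
        zify
        exact ⟨l, by rw [hk]; ring⟩
      exact hpp.one_lt.ne' (Nat.isUnit_iff.mp (hm p this))
    have h1 : (p : ℤ) ∣ k * (y ^ 2 - 2 * q) := by
      refine ⟨-(e' ^ 2 + 2 * q * R' ^ 2), mul_left_cancel₀ hpZ.ne_zero ?_⟩
      linear_combination -he + 2 * q * hR + (2 * q - y ^ 2) * hk
    have h2 : (p : ℤ) ∣ y ^ 2 + 1 ^ 2 := by
      have := ((hpZ.dvd_or_dvd h1).resolve_left hpk).add
        ((hk ▸ dvd_mul_right (p : ℤ) k : (p : ℤ) ∣ m).trans hmq)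
      rwa [show y ^ 2 - 2 * q + (2 * q + 1) = y ^ 2 + 1 ^ 2 by ring] at this
    exact absurd (Int.dvd_and_dvd_of_prime_dvd_sq_add_sq hp4 h2).2 hpZ.not_dvd_one
  · have hpR : ¬ (p : ℤ) ∣ R := fun h =>
      hpm (hR ▸ (dvd_pow h two_ne_zero).add hpv)
    have hdiv : ¬ (p : ℤ) ∣ 2 * q - y ^ 2 := by
      intro h
      have hy := (hpZ.dvd_or_dvd (Int.dvd_and_dvd_of_prime_dvd_sq_add_sq hp4
        (hkey ▸ hpv.mul_right _)).2).resolve_left hpR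
      have h2q : (p : ℤ) ∣ 2 * q := by
        simpa using h.add (dvd_pow hy two_ne_zero)
      rcases hpp.dvd_mul.mp (mod_cast h2q : p ∣ 2 * q) with h | h
      · have := (Nat.prime_dvd_prime_iff_eq hpp Nat.prime_two).mp h
        lia
      · have := (Nat.prime_dvd_prime_iff_eq hpp hq).mp h
        lia
    obtain ⟨c, hc⟩ : ∃ c : ℕ, (c : ℤ) = 2 * q - y ^ 2 := by
      refine ⟨_, Int.toNat_of_nonneg (nonneg_of_mul_nonneg_right (a := (2 * v : ℤ)) ?_ ?_)⟩
      · rw [hkey]; positivity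
      · positivity
    have hpc : ¬ p ∣ c := by
      rw [← hc] at hdiv
      exact mod_cast hdiv
    have hprod : 2 * v * c = e.natAbs ^ 2 + (R * y).natAbs ^ 2 := by
      zify
      rw [hc, sq_abs, sq_abs, hkey]
    have hc0 : c ≠ 0 := by rintro rfl; simp at hpc
    have heven := Nat.eq_sq_add_sq_iff.mp ⟨_, _, hprod⟩ p
      (Nat.mem_primeFactors.mpr ⟨hpp, (Nat.dvd_of_mem_primeFactors hp).mul_right c, by positivity⟩)
      hp4
    rwa [padicValNat.mul (by positivity) hc0, padicValNat.eq_zero_of_not_dvd hpc,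
      add_zero] at heven

theorem exists_prime_jacobiSym_neg_eq_one {m : ℕ} (hm : m % 8 = 3) :
    ∃ q : ℕ, q.Prime ∧ q % 4 = 1 ∧ (m : ℤ) ∣ 2 * q + 1 ∧ jacobiSym (-m) q = 1 := by
  obtain ⟨k, rfl⟩ : ∃ k, m = 8 * k + 3 := ⟨m / 8, by lia⟩
  have hcop : (4 * k + 1).Coprime (4 * (8 * k + 3)) := by
    rw [← Nat.isCoprime_iff_coprime]
    exact ⟨1 + 8 * k, -k, by push_cast; ring⟩
  obtain ⟨q, -, hq, hqk⟩ := Nat.forall_exists_prime_gt_and_modEq 0 (by lia) hcop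
  have hq4 : q % 4 = 1 := by
    have := hqk.of_mul_right (8 * k + 3)
    rw [Nat.ModEq] at this
    lia
  have hdvd : ((8 * k + 3 : ℕ) : ℤ) ∣ 2 * q + 1 := by
    have h := (Nat.modEq_iff_dvd.mp (hqk.of_mul_left 4)).mul_left 2
    have h' := (dvd_refl ((8 * k + 3 : ℕ) : ℤ)).sub h
    rwa [show ((8 * k + 3 : ℕ) : ℤ) - 2 * (((4 * k + 1 : ℕ) : ℤ) - q) = 2 * q + 1 by
      push_cast; ring] at h'
  refine ⟨q, hq, hq4, hdvd, ?_⟩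
  have hm_odd : Odd (8 * k + 3) := Nat.odd_iff.mpr (by lia)
  have h1 : jacobiSym (-2) (8 * k + 3) = 1 := by
    rw [jacobiSym.at_neg_two hm_odd, ZMod.χ₈'_nat_eq_if_mod_eight, if_neg (by lia),
      if_pos (by lia)]
  have h2 : jacobiSym (-2 * q) (8 * k + 3) = 1 := by
    rw [← jacobiSym.one_left (8 * k + 3)]
    refine jacobiSym.mod_left' (Int.modEq_iff_dvd.mpr ?_)
    rwa [show (1 - -2 * q : ℤ) = 2 * q + 1 by ring]
  rw [jacobiSym.neg _ (Nat.odd_iff.mpr (by lia)), ZMod.χ₄_nat_one_mod_four hq4, one_mul,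
    ← jacobiSym.quadratic_reciprocity_one_mod_four hq4 hm_odd]
  rwa [jacobiSym.mul_left, h1, one_mul] at h2

theorem exists_sq_add_eq_four_mul {m q : ℕ} (hm : m % 4 = 3) (hq : q.Prime)
    (hq4 : q % 4 = 1) (hJ : jacobiSym (-m) q = 1) : ∃ b h : ℤ, b ^ 2 + m = 4 * q * h := by
  have : Fact q.Prime := ⟨hq⟩
  obtain ⟨a, ha⟩ := ZMod.isSquare_of_jacobiSym_eq_one hJ
  obtain ⟨a, rfl⟩ := ZMod.intCast_surjective a
  have hdvd : (q : ℤ) ∣ a ^ 2 + m := by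
    rw [← ZMod.intCast_zmod_eq_zero_iff_dvd]
    push_cast at ha ⊢
    linear_combination -ha
  obtain ⟨b, hb, hbq⟩ : ∃ b : ℤ, Odd b ∧ (q : ℤ) ∣ b ^ 2 + m := by
    rcases Int.even_or_odd a with h | h
    · refine ⟨a + q, h.add_odd (mod_cast Nat.odd_iff.mpr (by lia)), ?_⟩
      rw [show (a + q) ^ 2 + m = a ^ 2 + m + q * (2 * a + q) by ring]
      exact hdvd.add (dvd_mul_right _ _)
    · exact ⟨a, h, hdvd⟩
  have h4 : (4 : ℤ) ∣ b ^ 2 + m := by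
    have := Int.sq_mod_four_eq_one_of_odd hb
    lia
  have hcop : IsCoprime (4 : ℤ) q := ⟨-(q / 4), 1, by lia⟩
  obtain ⟨h, hh⟩ := hcop.mul_dvd h4 hbq
  exact ⟨b, h, hh⟩

theorem exists_eq_sum_three_sq_of_squarefree {m : ℕ} (hsq : Squarefree m) (hm : m % 8 = 3) :
    ∃ x y z : ℤ, x ^ 2 + y ^ 2 + z ^ 2 = m := by
  obtain ⟨q, hq, hq4, hmq, hJ⟩ := exists_prime_jacobiSym_neg_eq_one hm
  obtain ⟨b, h, hbh⟩ := exists_sq_add_eq_four_mul (by lia) hq hq4 hJ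
  have hm0 : (0 : ℤ) < m := by lia
  have hq0 : (0 : ℤ) < q := mod_cast hq.pos
  obtain ⟨x, y, z, hne, hlt⟩ := exists_int_ne_zero_ankeny_form_lt (m := m) (q := q)
    (by exact_mod_cast hm0) (by exact_mod_cast hq0) b
  norm_cast at hlt
  set e := 2 * q * x + b * y with he
  set R := e + m * z with hR
  set v := q * x ^ 2 + b * x * y + h * y ^ 2 with hv
  have hev : 4 * q * v = e ^ 2 + m * y ^ 2 := by
    rw [hv, he]
    linear_combination -y ^ 2 * hbh
  have hv0 : 0 ≤ v := by
    refine nonneg_of_mul_nonneg_right (a := (4 * q : ℤ)) ?_ (by positivity)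
    rw [hev]; positivity
  have hform : 2 * q * R ^ 2 + e ^ 2 + m * y ^ 2 = 2 * q * (R ^ 2 + 2 * v) := by
    linear_combination -hev
  have hlt' : R ^ 2 + 2 * v < 2 * m := by
    refine lt_of_mul_lt_mul_left (a := (2 * q : ℤ)) ?_ (by positivity)
    rw [← hform]
    exact hlt
  have hdvd : (m : ℤ) ∣ R ^ 2 + 2 * v := by
    have h1 : (m : ℤ) ∣ 2 * q * (R ^ 2 + 2 * v) := by
      rw [← hform, hR]
      obtain ⟨c, hc⟩ := hmq
      exact ⟨c * e ^ 2 + 2 * q * (2 * e * z + m * z ^ 2) + y ^ 2, by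
        linear_combination e ^ 2 * hc⟩
    have h2 : IsCoprime (m : ℤ) (2 * q) := by
      obtain ⟨c, hc⟩ := hmq
      exact ⟨c, -1, by linear_combination -hc⟩
    exact h2.dvd_of_dvd_mul_left h1
  have hpos : 0 < R ^ 2 + 2 * v := by
    refine lt_of_le_of_ne (by positivity) fun h0 => hne ?_
    have hR0 : R = 0 := by nlinarith [sq_nonneg R]
    have hv00 : v = 0 := by nlinarith [sq_nonneg R]
    rw [hv00, mul_zero] at hev
    have hy : y = 0 := by
      by_contra hy
      have : 0 < e ^ 2 + m * y ^ 2 := by positivity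
      lia
    have he0 : e = 0 := by simpa [hy] using hev.symm
    have hx : x = 0 := by
      have : 2 * q * x = 0 := by rw [← he0, he, hy]; ring
      simpa [hq.ne_zero] using this
    have hz : z = 0 := by
      have : m * z = 0 := by rw [← hR0, hR, he0]; ring
      simpa [hsq.ne_zero] using this
    exact ⟨hx, hy, hz⟩
  have hRv : R ^ 2 + 2 * v = m := by
    obtain ⟨c, hc⟩ := hdvd
    have hc0 : 0 < c := by
      rw [hc] at hpos
      exact pos_of_mul_pos_right hpos hm0.le
    have hc2 : c < 2 := by
      rw [hc, mul_comm] at hlt'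
      exact lt_of_mul_lt_mul_right hlt' hm0.le
    rw [hc, show c = 1 by lia, mul_one]
  clear_value v
  lift v to ℕ using hv0
  rcases v.eq_zero_or_pos with rfl | hvpos
  · exact ⟨R, 0, 0, by simpa using hRv⟩
  · obtain ⟨S, T, hST⟩ := two_mul_eq_sq_add_sq_of_ankeny hsq hq hq4 hmq hvpos hRv hev
    zify at hST
    exact ⟨R, S, T, by rw [← hRv, hST]; ring⟩

theorem exists_eq_sum_three_sq_of_mod_eight_eq_three {m : ℕ} (hm : m % 8 = 3) :
    ∃ x y z : ℤ, x ^ 2 + y ^ 2 + z ^ 2 = m := by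
  obtain ⟨s, k, rfl, hs⟩ := Nat.sq_mul_squarefree m
  have hk : k % 2 = 1 := by
    rcases Nat.mod_two_eq_zero_or_one k with h | h
    · obtain ⟨l, rfl⟩ := Nat.dvd_of_mod_eq_zero h
      rw [show (2 * l) ^ 2 * s = 4 * (l ^ 2 * s) by ring] at hm
      lia
    · exact h
  have hs8 : s % 8 = 3 := by
    have hk8 : k ^ 2 % 8 = 1 := by
      exact_mod_cast Int.sq_mod_eight_eq_one_of_odd (mod_cast Nat.odd_iff.mpr hk : Odd (k : ℤ))
    rw [Nat.mul_mod, hk8] at hm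
    lia
  obtain ⟨x, y, z, h⟩ := exists_eq_sum_three_sq_of_squarefree hs hs8
  exact ⟨k * x, k * y, k * z, by push_cast; rw [← h]; ring⟩

theorem euler_conjecture (n : ℤ) (hn : 0 < n) (hodd : Odd n) :
    ∃ a b c d : ℤ, a^2 + b^2 + c^2 + d^2 = n ∧ a + b + c + d = 1 := by
  obtain ⟨k, rfl⟩ := hodd
  obtain ⟨x, y, z, h⟩ := exists_eq_sum_three_sq_of_mod_eight_eq_three
    (m := (8 * k + 3).toNat) (by lia)
  rw [Int.toNat_of_nonneg (by lia)] at h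
  have hsq8 (w : ℤ) : w % 2 = 1 ∧ w ^ 2 % 8 = 1 ∨ w % 2 = 0 ∧ w ^ 2 % 4 = 0 := by
    rcases Int.even_or_odd w with hw | hw
    · right
      obtain ⟨l, rfl⟩ := hw
      exact ⟨by lia, by ring_nf; lia⟩
    · exact Or.inl ⟨Int.odd_iff.mp hw, Int.sq_mod_eight_eq_one_of_odd hw⟩
  have hx := hsq8 x
  have hy := hsq8 y
  have hz := hsq8 z
  obtain ⟨w, hw, hwz⟩ : ∃ w : ℤ, w ^ 2 = z ^ 2 ∧ (1 + x + y + w) % 4 = 0 := by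
    rcases (by lia : (1 + x + y + z) % 4 = 0 ∨ (1 + x + y + -z) % 4 = 0) with h4 | h4
    · exact ⟨z, rfl, h4⟩
    · exact ⟨-z, neg_sq z, h4⟩
  obtain ⟨a, ha⟩ := Int.dvd_of_emod_eq_zero hwz
  obtain ⟨b, hb⟩ : (2 : ℤ) ∣ y + w := by lia
  obtain ⟨c, hc⟩ : (2 : ℤ) ∣ x + w := by lia
  obtain ⟨d, hd⟩ : (2 : ℤ) ∣ x + y := by lia
  refine ⟨a, a - b, a - c, a - d, mul_left_cancel₀ (four_ne_zero (α := ℤ)) ?_, by lia⟩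
  obtain rfl : x = c + d - b := by lia
  obtain rfl : y = b + d - c := by lia
  obtain rfl : w = b + c - d := by lia
  obtain rfl : b = 4 * a - 1 - c - d := by lia
  linear_combination h + hw
end

section
/- For every nonnegative integer n, there exist integers a, b, c, d with a² + b² + c² + d² = n such that a + b + c + d is a perfect square. -/
theorem exists_two_mul_abs_add_mul_le (b a : ℤ) (ha : 0 < a) : ∃ k : ℤ, 2 * |b + k * a| ≤ a := by
  have h0 := Int.emod_nonneg b ha.ne'
  have h1 := Int.emod_lt_of_pos b ha
  have h2 := Int.mul_ediv_add_emod b a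
  rcases le_total (2 * (b % a)) a with h | h
  · refine ⟨-(b / a), ?_⟩
    rw [show b + -(b / a) * a = b % a by linarith, abs_of_nonneg h0]
    exact h
  · refine ⟨-(b / a) - 1, ?_⟩
    rw [show b + (-(b / a) - 1) * a = b % a - a by linarith, abs_of_neg (by linarith)]
    linarith

/-- A positive definite ternary quadratic form over `ℤ` with even cross terms and determinant `1`
represents only sums of three squares. -/
theorem ternary_form_eq_sum_three_sq (a b c r s t : ℤ) (ha : 0 < a) (hA : 0 < a * b - t ^ 2)
    (hdet : a * b * c + 2 * r * s * t - a * r ^ 2 - b * s ^ 2 - c * t ^ 2 = 1) (x y z : ℤ) :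
    ∃ u v w : ℤ, a * x ^ 2 + b * y ^ 2 + c * z ^ 2 + 2 * r * (y * z) + 2 * s * (x * z)
      + 2 * t * (x * y) = u ^ 2 + v ^ 2 + w ^ 2 := by
  obtain ⟨A, hAdef⟩ : ∃ A, A = a * b - t ^ 2 := ⟨_, rfl⟩
  obtain ⟨B, hBdef⟩ : ∃ B, B = a * r - s * t := ⟨_, rfl⟩
  rw [← hAdef] at hA
  by_cases hred : 4 * a < 3 * A ^ 2
  · obtain ⟨k, hk⟩ := exists_two_mul_abs_add_mul_le B A hA
    obtain ⟨C, hCdef⟩ : ∃ C, C = a * (c + 2 * k * r + k ^ 2 * b) - (s + k * t) ^ 2 := ⟨_, rfl⟩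
    have hAC : A * C = a + (B + k * A) ^ 2 := by
      rw [hAdef, hBdef, hCdef]; linear_combination a * hdet
    have hC : 0 < C := by nlinarith [sq_nonneg (B + k * A)]
    have hlt : C < A := by
      have : 4 * (B + k * A) ^ 2 ≤ A ^ 2 := by
        have := pow_le_pow_left₀ (by positivity) hk 2
        rw [mul_pow, sq_abs] at this; linarith
      nlinarith
    have hdec : (a * (c + 2 * k * r + k ^ 2 * b) - (s + k * t) ^ 2).toNat
        < (a * b - t ^ 2).toNat := by omega
    obtain ⟨u, v, w, h⟩ := ternary_form_eq_sum_three_sq a (c + 2 * k * r + k ^ 2 * b) b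
      (r + k * b) t (s + k * t) ha (hCdef ▸ hC) (by linear_combination hdet) x z (y - k * z)
    exact ⟨u, v, w, by rw [← h]; ring⟩
  · by_cases ha1 : a = 1
    · have hA1 : A = 1 := by nlinarith
      subst ha1
      refine ⟨x + t * y + s * z, y + B * z, z, ?_⟩
      have hb : b = 1 + t ^ 2 := by linarith
      subst hb hBdef
      linear_combination z ^ 2 * hdet
    · obtain ⟨k, hk⟩ := exists_two_mul_abs_add_mul_le t a ha
      obtain ⟨b', hb'⟩ : ∃ b', b' = b + 2 * k * t + k ^ 2 * a := ⟨_, rfl⟩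
      have hab : a * b' = A + (t + k * a) ^ 2 := by rw [hAdef, hb']; ring
      have hpos : 0 < b' := by nlinarith [sq_nonneg (t + k * a)]
      have hlt : b' < a := by
        have h4 : 4 * (t + k * a) ^ 2 ≤ a ^ 2 := by
          have := pow_le_pow_left₀ (by positivity) hk 2
          rw [mul_pow, sq_abs] at this; linarith
        have ha2 : 2 ≤ a := by omega
        have hAa : A < a := by nlinarith
        nlinarith
      have hdec : (b + 2 * k * t + k ^ 2 * a).toNat < a.toNat := by omega
      obtain ⟨u, v, w, h⟩ := ternary_form_eq_sum_three_sq (b + 2 * k * t + k ^ 2 * a) a c s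
        (r + k * s) (t + k * a) (hb' ▸ hpos) (by linarith) (by linear_combination hdet)
        y (x - k * y) z
      exact ⟨u, v, w, by rw [← h]; ring⟩
termination_by (a.toNat, (a * b - t ^ 2).toNat)

theorem sum_three_sq_of_dvd_sq_add {n d t : ℤ} (hd : 0 < d) (hpos : 0 < d * n - 1)
    (hdvd : d * n - 1 ∣ t ^ 2 + d) : ∃ x y z : ℤ, n = x ^ 2 + y ^ 2 + z ^ 2 := by
  obtain ⟨a, ha⟩ := hdvd
  have ha0 : 0 < a := by
    by_contra! h
    nlinarith [sq_nonneg t]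
  obtain ⟨u, v, w, h⟩ := ternary_form_eq_sum_three_sq a (d * n - 1) n 0 1 t ha0 (by linarith)
    (by linear_combination (-n) * ha) 0 0 1
  exact ⟨u, v, w, by rw [← h]; ring⟩

theorem exists_dvd_sq_add_of_jacobiSym_eq_one {p d : ℕ} (hp : p.Prime)
    (h : jacobiSym (-d) p = 1) : ∃ t : ℤ, (p : ℤ) ∣ t ^ 2 + d := by
  have := Fact.mk hp
  obtain ⟨y, hy⟩ := ZMod.isSquare_of_jacobiSym_eq_one h
  obtain ⟨t, rfl⟩ := ZMod.intCast_surjective y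
  refine ⟨t, (ZMod.intCast_zmod_eq_zero_iff_dvd _ p).1 ?_⟩
  push_cast at hy ⊢
  linear_combination -hy

theorem sum_three_sq_of_mod_four_eq_two {n : ℕ} (hn : n % 4 = 2) :
    ∃ x y z : ℤ, (n : ℤ) = x ^ 2 + y ^ 2 + z ^ 2 := by
  have hcop : (n - 1).Coprime (4 * n) := by
    apply Nat.Coprime.mul_right
    · have : (n - 1).Coprime 2 := by
        rw [Nat.coprime_two_right, Nat.odd_iff]; omega
      simpa using Nat.Coprime.pow_right 2 this
    · have := Nat.coprime_self_add_right.2 (Nat.coprime_one_right (n - 1))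
      rwa [Nat.sub_add_cancel (by omega)] at this
  obtain ⟨p, hpgt, hp, hmod⟩ := Nat.forall_exists_prime_gt_and_modEq (n - 1) (by omega) hcop
  obtain ⟨v, hv⟩ := (Nat.modEq_iff_dvd' hpgt.le).1 hmod.symm
  have hpd : p + 1 = (4 * v + 1) * n := by
    have : (4 * v + 1) * n = 4 * n * v + n := by ring
    omega
  have hp4 : p % 4 = 1 := by
    rw [mul_assoc] at hv; omega
  have hdodd : Odd (4 * v + 1) := by rw [Nat.odd_iff]; omega
  have hj : jacobiSym (-(4 * v + 1 : ℕ)) p = 1 := by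
    have hpodd : Odd p := by rw [Nat.odd_iff]; omega
    rw [jacobiSym.neg _ hpodd, ZMod.χ₄_nat_one_mod_four hp4, one_mul,
      jacobiSym.quadratic_reciprocity_one_mod_four (by omega) hpodd]
    have hm : ((p : ℤ)) % (4 * v + 1 : ℕ) = (-1) % (4 * v + 1 : ℕ) := by
      apply Int.ModEq.symm
      rw [Int.modEq_iff_dvd]
      exact ⟨n, by rw [sub_neg_eq_add]; exact_mod_cast hpd⟩
    rw [jacobiSym.mod_left' hm, jacobiSym.at_neg_one hdodd, ZMod.χ₄_nat_one_mod_four (by omega)]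
  obtain ⟨t, ht⟩ := exists_dvd_sq_add_of_jacobiSym_eq_one hp hj
  have hpz : ((4 * v + 1 : ℕ) : ℤ) * n - 1 = p := by
    rw [sub_eq_iff_eq_add]; exact_mod_cast hpd.symm
  refine sum_three_sq_of_dvd_sq_add (d := (4 * v + 1 : ℕ)) (by positivity) ?_ (t := t) ?_
  · rw [hpz]; exact_mod_cast hp.pos
  · rwa [hpz]

theorem sum_three_sq_of_mod_eight_odd {n : ℕ} (hn : n % 8 = 1 ∨ n % 8 = 3 ∨ n % 8 = 5) :
    ∃ x y z : ℤ, (n : ℤ) = x ^ 2 + y ^ 2 + z ^ 2 := by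
  obtain ⟨c, q, hc, hq⟩ : ∃ c q : ℕ, (c = 3 ∧ (n % 8 = 1 ∨ n % 8 = 5) ∨ c = 1 ∧ n % 8 = 3) ∧
      2 * q + 1 = c * n := by
    rcases hn with h | h | h
    · exact ⟨3, (3 * n - 1) / 2, by omega, by omega⟩
    · exact ⟨1, (n - 1) / 2, by omega, by omega⟩
    · exact ⟨3, (3 * n - 1) / 2, by omega, by omega⟩
  have hqodd : Odd q := by
    rw [Nat.odd_iff]
    rcases hc with ⟨rfl, h⟩ | ⟨rfl, h⟩ <;> omega
  have hcop : q.Coprime (4 * n) := by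
    apply Nat.Coprime.mul_right
    · simpa using Nat.Coprime.pow_right 2 (Nat.coprime_two_right.2 hqodd)
    · have : q.Coprime (c * n) := by
        rw [← hq, Nat.coprime_mul_right_add_right]
        exact Nat.coprime_one_right q
      exact this.coprime_mul_left_right
  obtain ⟨p, hpgt, hp, hmod⟩ := Nat.forall_exists_prime_gt_and_modEq q (by omega) hcop
  obtain ⟨v, hv⟩ := (Nat.modEq_iff_dvd' hpgt.le).1 hmod.symm
  obtain ⟨d, hd⟩ : ∃ d, d = 8 * v + c := ⟨_, rfl⟩
  have hpd : 2 * p + 1 = d * n := by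
    have : d * n = 2 * (4 * n * v) + c * n := by rw [hd]; ring
    omega
  have hpq : p % 4 = q % 4 := by
    rw [mul_assoc] at hv; omega
  have hpodd : Odd p := by rw [Nat.odd_iff] at hqodd ⊢; omega
  have hdodd : Odd d := by rw [Nat.odd_iff]; omega
  have hpd1 : jacobiSym p d = 1 := by
    have hm : (-2 * (p : ℤ)) % d = 1 % d := by
      apply Int.ModEq.symm
      rw [Int.modEq_iff_dvd]
      refine ⟨-n, ?_⟩
      have : 2 * (p : ℤ) + 1 = d * n := by exact_mod_cast hpd
      linear_combination -this
    have h1 : jacobiSym (-2 * (p : ℤ)) d = 1 := by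
      rw [jacobiSym.mod_left' hm, jacobiSym.one_left]
    have h2 : jacobiSym (-2) d = 1 := by
      rw [jacobiSym.at_neg_two hdodd, ZMod.χ₈'_nat_eq_if_mod_eight]
      rw [if_neg (by omega), if_pos (by omega)]
    rwa [jacobiSym.mul_left, h2, one_mul] at h1
  have hj : jacobiSym (-d) p = 1 := by
    rw [jacobiSym.neg _ hpodd]
    rcases hc with ⟨rfl, h | h⟩ | ⟨rfl, h⟩
    · have hp4 : p % 4 = 1 := by omega
      rw [ZMod.χ₄_nat_one_mod_four hp4, one_mul,
        ← jacobiSym.quadratic_reciprocity_one_mod_four hp4 hdodd, hpd1]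
    · rw [ZMod.χ₄_nat_three_mod_four (by omega),
        jacobiSym.quadratic_reciprocity_three_mod_four (by omega) (by omega), hpd1]
      rfl
    · have hp4 : p % 4 = 1 := by omega
      rw [ZMod.χ₄_nat_one_mod_four hp4, one_mul,
        ← jacobiSym.quadratic_reciprocity_one_mod_four hp4 hdodd, hpd1]
  obtain ⟨t, ht, htodd⟩ : ∃ t : ℤ, (p : ℤ) ∣ t ^ 2 + d ∧ Odd t := by
    obtain ⟨t, ht⟩ := exists_dvd_sq_add_of_jacobiSym_eq_one hp hj
    rcases Int.even_or_odd t with h | h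
    · refine ⟨t + p, ?_, h.add_odd (by exact_mod_cast hpodd)⟩
      have : (t + p) ^ 2 + (d : ℤ) = (t ^ 2 + d) + p * (2 * t + p) := by ring
      rw [this]
      exact dvd_add ht (dvd_mul_right _ _)
    · exact ⟨t, ht, h⟩
  have hpz : (d : ℤ) * n - 1 = 2 * p := by
    rw [sub_eq_iff_eq_add]; exact_mod_cast hpd.symm
  refine sum_three_sq_of_dvd_sq_add (d := d) (by omega) ?_ (t := t) ?_
  · have := hp.pos
    omega
  · rw [hpz]
    refine IsCoprime.mul_dvd ?_ ?_ ht
    · exact_mod_cast Nat.isCoprime_iff_coprime.2 (Nat.coprime_two_left.2 hpodd)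
    · exact (htodd.pow.add_odd (by exact_mod_cast hdodd)).two_dvd

theorem sum_three_sq_of_mod_eight {n : ℕ} (h0 : n % 4 ≠ 0) (h7 : n % 8 ≠ 7) :
    ∃ x y z : ℤ, (n : ℤ) = x ^ 2 + y ^ 2 + z ^ 2 := by
  by_cases h : n % 4 = 2
  · exact sum_three_sq_of_mod_four_eq_two h
  · exact sum_three_sq_of_mod_eight_odd (by omega)

theorem sum_is_square (n : ℕ) :
    ∃ a b c d : ℤ, a^2 + b^2 + c^2 + d^2 = (n : ℤ) ∧ ∃ m : ℤ, 0 ≤ m ∧ a + b + c + d = m^2 := by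
  induction n using Nat.strong_induction_on with
  | _ n ih =>
  rcases Nat.eq_zero_or_pos n with rfl | hn
  · exact ⟨0, 0, 0, 0, by simp, 0, le_rfl, by simp⟩
  by_cases hodd : n % 2 = 1
  · obtain ⟨x, y, z, h⟩ := sum_three_sq_of_mod_eight (n := 4 * n - 1) (by omega) (by omega)
    rw [Nat.cast_sub (by omega)] at h
    push_cast at h
    have hsq (k : ℤ) : k % 2 = 0 ∧ k ^ 2 % 4 = 0 ∨ k % 2 = 1 ∧ k ^ 2 % 4 = 1 := by
      rcases Int.even_or_odd' k with ⟨j, rfl | rfl⟩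
      · left; ring_nf; omega
      · right; ring_nf; omega
    have hxyz : x % 2 = 1 ∧ y % 2 = 1 ∧ z % 2 = 1 := by
      have := hsq x; have := hsq y; have := hsq z
      omega
    obtain ⟨w, hw, hw4⟩ : ∃ w : ℤ, w ^ 2 = z ^ 2 ∧ (1 + x + y + w) % 4 = 0 := by
      by_cases hz : (1 + x + y + z) % 4 = 0
      · exact ⟨z, rfl, hz⟩
      · exact ⟨-z, by ring, by omega⟩
    rw [← hw] at h
    obtain ⟨a, ha⟩ : ∃ a, w = 4 * a - 1 - x - y := ⟨(1 + x + y + w) / 4, by omega⟩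
    obtain ⟨i, rfl⟩ : ∃ i, x = 2 * i + 1 := ⟨x / 2, by omega⟩
    obtain ⟨j, rfl⟩ : ∃ j, y = 2 * j + 1 := ⟨y / 2, by omega⟩
    subst ha
    refine ⟨a, i + 1 - a, j + 1 - a, a - i - j - 1, ?_, 1, by norm_num, by ring⟩
    linarith
  by_cases h2 : n % 4 = 2
  · obtain ⟨x, y, z, h⟩ := sum_three_sq_of_mod_four_eq_two h2
    have hsum : (x + y + z) % 2 = 0 := by
      have hsq (k : ℤ) : k ^ 2 % 2 = k % 2 := by
        rcases Int.even_or_odd' k with ⟨j, rfl | rfl⟩ <;> ring_nf <;> omega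
      have := hsq x; have := hsq y; have := hsq z
      omega
    obtain ⟨a, ha⟩ : ∃ a, z = 2 * a - x - y := ⟨(x + y + z) / 2, by omega⟩
    subst ha
    exact ⟨a, x - a, y - a, a - x - y, by rw [h]; ring, 0, le_rfl, by ring⟩
  obtain ⟨m, rfl⟩ : ∃ m, n = 4 * m := ⟨n / 4, by omega⟩
  by_cases h0 : m % 4 = 0
  · obtain ⟨k, rfl⟩ : ∃ k, m = 4 * k := ⟨m / 4, by omega⟩
    obtain ⟨a, b, c, d, h, s, hs, hsum⟩ := ih k (by omega)
    refine ⟨4 * a, 4 * b, 4 * c, 4 * d, ?_, 2 * s, by positivity, by linear_combination 4 * hsum⟩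
    push_cast
    linear_combination 16 * h
  by_cases h7 : m % 8 = 7
  · obtain ⟨x, y, z, h⟩ := sum_three_sq_of_mod_eight (n := m - 1) (by omega) (by omega)
    rw [Nat.cast_sub (by omega)] at h
    refine ⟨1 + x + y + z, 1 + x - y - z, 1 - x + y - z, 1 - x - y + z, ?_, 2, by norm_num,
      by ring⟩
    push_cast at h ⊢
    linear_combination -4 * h
  · obtain ⟨x, y, z, h⟩ := sum_three_sq_of_mod_eight h0 h7
    refine ⟨x + y + z, x - y - z, -x + y - z, -x - y + z, ?_, 0, le_rfl, by ring⟩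
    push_cast
    linear_combination -4 * h
end
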